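/- arXiv:2502.12569 — 3 statements merged into one kernel-verified Lean document; each statement's English description precedes it below -/
import Mathlib

section
/- Let (N, beats) be a tournament on n players and p : N → {0,1}. Let 𝒫 = {i ∈ N : p(i) = 1}, let 𝒲 = {i ∈ N : p(i) = 0 and i beats every player of 𝒫}, and let 𝒰 = {i ∈ N : p(i) = 0 and some player of 𝒫 beats i}. If 𝒫 ≠ ∅, then the maximum of V_p(σ) over all seedings σ equals |𝒫| + |𝒰| − 1. -/
open Finset

noncomputable section
open scoped Classical

variable {P : Type*}

/-- The list of (winner, loser) pairs of the matches played in a Challenge the Champ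
tournament whose current champ is `c` and whose remaining challengers, in order, are
the given list. -/
def ctcMatches (beats : P → P → Prop) : P → List P → List (P × P)
  | _, [] => []
  | c, x :: xs =>
    if beats c x then (c, x) :: ctcMatches beats c xs
    else (x, c) :: ctcMatches beats x xs

/-- The final champ of a Challenge the Champ tournament whose current champ is `c` and
whose remaining challengers, in order, are the given list. -/
def ctcChamp (beats : P → P → Prop) : P → List P → P
  | c, [] => c
  | c, x :: xs => if beats c x then ctcChamp beats c xs else ctcChamp beats x xs

/-- The (winner, loser) pairs of matches of a Challenge the Champ tournament whose
seeding is given as a list of players. -/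
def ctcMatchesL (beats : P → P → Prop) : List P → List (P × P)
  | [] => []
  | c :: xs => ctcMatches beats c xs

/-- The winner of a Challenge the Champ tournament seeded by a list of players. -/
def ctcWinnerL (beats : P → P → Prop) : List P → Option P
  | [] => none
  | c :: xs => some (ctcChamp beats c xs)

/-- The (winner, loser) pairs of the matches played under the seeding `σ`. -/
def matchesOf (beats : P → P → Prop) {n : ℕ} (σ : Fin n → P) : List (P × P) :=
  ctcMatchesL beats (List.ofFn σ)

/-- The winner of the Challenge the Champ tournament under the seeding `σ`. -/
def winnerOf (beats : P → P → Prop) {n : ℕ} (σ : Fin n → P) : Option P :=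
  ctcWinnerL beats (List.ofFn σ)

/-- `M_i(σ)`: the set of players who play a match against `i` and lose it. -/
def Mset [Fintype P] (beats : P → P → Prop) {n : ℕ} (σ : Fin n → P) (i : P) : Finset P :=
  univ.filter fun j => (i, j) ∈ matchesOf beats σ

/-- `w_i(σ)`: the number of matches won by player `i`. -/
def wins [Fintype P] (beats : P → P → Prop) {n : ℕ} (σ : Fin n → P) (i : P) : ℕ :=
  (Mset beats σ i).card

/-- The player-popularity-based tournament value of a seeding: each match contributes
the popularity of its winner. -/
def Vpop [Fintype P] (beats : P → P → Prop) {n : ℕ} (σ : Fin n → P) (p : P → ℕ) : ℕ :=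
  ∑ i, p i * wins beats σ i

section Matches

variable {beats : P → P → Prop}

lemma ctcChamp_cons_losers_perm (c : P) (xs : List P) :
    (ctcChamp beats c xs :: (ctcMatches beats c xs).map Prod.snd).Perm (c :: xs) := by
  induction xs generalizing c with
  | nil => simp [ctcChamp, ctcMatches]
  | cons x xs ih =>
    simp only [ctcChamp, ctcMatches]
    split_ifs with h
    · exact (List.Perm.swap _ _ _).trans (((ih c).cons x).trans (List.Perm.swap _ _ _))
    · exact (List.Perm.swap _ _ _).trans ((ih x).cons c)

lemma nodup_ctcMatchesL {l : List P} (hl : l.Nodup) : (ctcMatchesL beats l).Nodup := by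
  cases l with
  | nil => simp [ctcMatchesL]
  | cons c xs =>
    have h := (ctcChamp_cons_losers_perm (beats := beats) c xs).nodup_iff.mpr hl
    exact List.Nodup.of_map _ (List.nodup_cons.mp h).2

lemma Vpop_eq_sum_matches [Fintype P] {n : ℕ} (σ : Fin n ≃ P) (p : P → ℕ) :
    Vpop beats σ p = ((matchesOf beats σ).map fun m => p m.1).sum := by
  have hn : (matchesOf beats σ).Nodup :=
    nodup_ctcMatchesL (List.nodup_ofFn.mpr σ.injective)
  rw [← List.sum_toFinset _ hn]
  simp only [Vpop, wins, Mset, Finset.card_filter, Finset.mul_sum]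
  rw [← Fintype.sum_prod_type' (f := fun i j => p i * if (i, j) ∈ matchesOf beats σ then 1 else 0)]
  simp only [mul_ite, mul_one, mul_zero, ← Finset.sum_filter]
  refine Finset.sum_congr ?_ fun _ _ => rfl
  ext m
  simp

lemma sum_matches_eq_zero {p : P → ℕ} (c : P) (xs : List P) (h : ∀ x ∈ c :: xs, p x = 0) :
    ((ctcMatches beats c xs).map fun m => p m.1).sum = 0 := by
  induction xs generalizing c with
  | nil => simp [ctcMatches]
  | cons x xs ih =>
    simp only [List.mem_cons, forall_eq_or_imp] at h ih
    simp only [ctcMatches]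
    split_ifs
    · simp [h.1, ih c ⟨h.1, h.2.2⟩]
    · simp [h.2.1, ih x h.2]

/-- Apart from one popular player who never loses to a popular player, only players that are
popular or beaten by some popular player contribute a match. -/
lemma sum_matches_lt_countP (htot : ∀ i j : P, i ≠ j → (beats i j ↔ ¬ beats j i))
    {p : P → ℕ} (hp : ∀ i, p i = 0 ∨ p i = 1) (c : P) (xs : List P) (hn : (c :: xs).Nodup)
    (h : ∃ x ∈ c :: xs, p x = 1) :
    ((ctcMatches beats c xs).map fun m => p m.1).sum <
      (c :: xs).countP fun x => p x = 1 ∨ ∃ j, p j = 1 ∧ beats j x := by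
  induction xs generalizing c with
  | nil =>
    obtain ⟨x, hx, hpx⟩ := h
    rw [List.mem_singleton] at hx
    subst hx
    simp [ctcMatches, hpx]
  | cons x xs ih =>
    -- `a` wins against `b` and stays champ
    have key : ∀ a b, (a :: xs).Nodup → beats a b → (∃ y ∈ b :: a :: xs, p y = 1) →
        p a + ((ctcMatches beats a xs).map fun m => p m.1).sum <
          (b :: a :: xs).countP fun x => p x = 1 ∨ ∃ j, p j = 1 ∧ beats j x := by
      intro a b ha hab hex
      rw [List.countP_cons]
      by_cases hr : ∃ y ∈ a :: xs, p y = 1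
      · have := ih a ha hr
        rcases hp a with h0 | h1
        · omega
        · have hb : p b = 1 ∨ ∃ j, p j = 1 ∧ beats j b := Or.inr ⟨a, h1, hab⟩
          simp only [hb, decide_true, if_true]
          omega
      · have hz : ∀ y ∈ a :: xs, p y = 0 := fun y hy =>
          (hp y).resolve_right fun h1 => hr ⟨y, hy, h1⟩
        have hb : p b = 1 := by
          obtain ⟨y, hy, hpy⟩ := hex
          rcases List.mem_cons.mp hy with rfl | hy
          · exact hpy
          · exact absurd ⟨y, hy, hpy⟩ hr
        rw [sum_matches_eq_zero a xs hz, hz a (by simp)]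
        simp [hb]
    simp only [ctcMatches]
    have hn' := hn
    simp only [List.nodup_cons, List.mem_cons, not_or] at hn'
    obtain ⟨⟨hcx, hcxs⟩, hxxs, hxs⟩ := hn'
    split_ifs with hb
    · rw [((List.Perm.swap x c xs).countP_eq _), List.map_cons, List.sum_cons]
      refine key c x (List.nodup_cons.mpr ⟨hcxs, hxs⟩) hb ?_
      obtain ⟨y, hy, hpy⟩ := h
      exact ⟨y, (List.Perm.swap x c xs).mem_iff.mp hy, hpy⟩
    · rw [List.map_cons, List.sum_cons]
      exact key x c (List.nodup_cons.mpr ⟨hxxs, hxs⟩)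
        ((htot x c (Ne.symm hcx)).mpr hb) h

lemma ctcMatches_append {c : P} {as : List P} (h : ∀ a ∈ as, beats c a) (xs : List P) :
    ctcMatches beats c (as ++ xs) = as.map (fun a => (c, a)) ++ ctcMatches beats c xs := by
  induction as with
  | nil => simp
  | cons a as ih =>
    simp only [List.mem_cons, forall_eq_or_imp] at h
    simp [ctcMatches, h.1, ih h.2]

end Matches

lemma isChain_orderedInsert {r : P → P → Prop} [DecidableRel r] (hr : ∀ a b, r a b ∨ r b a)
    (a : P) {l : List P} (hl : l.IsChain r) : (l.orderedInsert r a).IsChain r := by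
  induction l with
  | nil => simp
  | cons b l ih =>
    rw [List.orderedInsert_cons]
    split_ifs with hab
    · exact List.isChain_cons_cons.mpr ⟨hab, hl⟩
    · have hba := (hr a b).resolve_left hab
      have h := ih hl.tail
      cases l with
      | nil => simpa using hba
      | cons d l =>
        rw [List.orderedInsert_cons] at h ⊢
        split_ifs at h ⊢
        · exact List.isChain_cons_cons.mpr ⟨hba, h⟩
        · exact List.isChain_cons_cons.mpr ⟨(List.isChain_cons_cons.mp hl).1, h⟩

/-- Insertion sort by a total relation yields a chain even without transitivity; for a tournament
this is a Hamiltonian path. -/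
lemma isChain_insertionSort {r : P → P → Prop} [DecidableRel r] (hr : ∀ a b, r a b ∨ r b a)
    (l : List P) : (l.insertionSort r).IsChain r := by
  induction l with
  | nil => simp
  | cons a l ih => exact isChain_orderedInsert hr a ih

/-- Each player of the first list is followed by those players of the second list that it beats
and that have not been placed before. -/
def seedGreedily (beats : P → P → Prop) : List P → List P → List P
  | [], us => us
  | v :: vs, us =>
    v :: (us.filter (fun u => beats v u) ++
      seedGreedily beats vs (us.filter fun u => ¬ beats v u))

lemma seedGreedily_perm (beats : P → P → Prop) (vs us : List P) :
    (seedGreedily beats vs us).Perm (vs ++ us) := by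
  induction vs generalizing us with
  | nil => simp [seedGreedily]
  | cons v vs ih =>
    simp only [seedGreedily, List.cons_append]
    refine List.Perm.cons v ?_
    refine ((ih _).append_left _).trans ?_
    refine List.perm_append_comm_assoc _ _ _ |>.trans (List.Perm.append_left _ ?_)
    simpa using List.filter_append_perm (fun u => decide (beats v u)) us

lemma le_sum_matches_seedGreedily {beats : P → P → Prop} {p : P → ℕ} (v : P) (vs us : List P)
    (hv : ∀ x ∈ v :: vs, p x = 1) (hc : (v :: vs).IsChain fun a b => ¬ beats a b) :
    vs.length + us.countP (fun u => ∃ j ∈ v :: vs, beats j u) ≤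
      ((ctcMatchesL beats (seedGreedily beats (v :: vs) us)).map fun m => p m.1).sum := by
  induction vs generalizing v us with
  | nil =>
    simp only [seedGreedily, ctcMatchesL]
    rw [ctcMatches_append (by simp)]
    simp [List.countP_eq_length_filter, hv v (by simp), Function.comp_def]
  | cons w vs ih =>
    have hvw := (List.isChain_cons_cons.mp hc).1
    have h := ih w (us.filter fun u => ¬ beats v u)
      (fun x hx => hv x (List.mem_cons_of_mem _ hx)) (List.isChain_cons_cons.mp hc).2
    rw [seedGreedily, ctcMatchesL, ctcMatches_append (by simp)]
    rw [seedGreedily, ctcMatchesL] at h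
    rw [seedGreedily, ctcMatches, if_neg hvw]
    have hcount : us.countP (fun u => ∃ j ∈ v :: w :: vs, beats j u) =
        (us.filter fun u => beats v u).length +
          (us.filter fun u => ¬ beats v u).countP fun u => ∃ j ∈ w :: vs, beats j u := by
      clear h
      induction us with
      | nil => simp
      | cons u us ihu =>
        rw [List.countP_cons, ihu]
        by_cases hu : beats v u
        · simp [hu]; omega
        · simp [hu, List.countP_cons]; omega
    have hpv := hv v (by simp)
    have hpw := hv w (by simp)
    simp only [List.map_append, List.sum_append, List.map_map, Function.comp_def, hpv,
      List.map_cons, List.sum_cons, hpw, List.map_const', List.sum_replicate, smul_eq_mul,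
      mul_one, List.length_cons, hcount]
    omega

lemma exists_equiv_ofFn_eq [Fintype P] {l : List P} (hn : l.Nodup) (hl : ∀ x, x ∈ l) :
    ∃ σ : Fin (Fintype.card P) ≃ P, List.ofFn σ = l := by
  have hlen : Fintype.card P = l.length := by
    simpa using (Fintype.card_congr (hn.getEquivOfForallMemList l hl)).symm
  rw [hlen]
  exact ⟨hn.getEquivOfForallMemList l hl, List.ofFn_get l⟩

lemma countP_eq_card_filter [Fintype P] {l : List P} (hn : l.Nodup) (hl : ∀ x, x ∈ l)
    (q : P → Prop) [DecidablePred q] : l.countP (fun x => q x) = (univ.filter q).card := by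
  rw [List.countP_eq_length_filter, ← List.toFinset_card_of_nodup (hn.filter _)]
  congr 1
  ext x
  simp [hl]

/-- Binary player-popularity values: if `𝒫` is the (nonempty) set of popular
players, `𝒲` the unpopular players beating every popular player, and `𝒰` the
unpopular players beaten by some popular player, then the maximum tournament value
over all seedings is `|𝒫| + |𝒰| − 1`. -/
theorem ctc_binary_popularity_optimum {P : Type*} [Fintype P]
    (beats : P → P → Prop)
    (hirr : ∀ i, ¬ beats i i)
    (htot : ∀ i j : P, i ≠ j → (beats i j ↔ ¬ beats j i))
    (p : P → ℕ) (hp : ∀ i, p i = 0 ∨ p i = 1)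
    (Pop W U : Finset P)
    (hPop : Pop = Finset.univ.filter fun i => p i = 1)
    (hW : W = Finset.univ.filter fun i => p i = 0 ∧ ∀ j ∈ Pop, beats i j)
    (hU : U = Finset.univ.filter fun i => p i = 0 ∧ ∃ j ∈ Pop, beats j i)
    (hPne : Pop.Nonempty) :
    IsGreatest
      (Set.range fun σ : Fin (Fintype.card P) ≃ P => Vpop beats (⇑σ) p)
      (Pop.card + U.card - 1) := by
  have hcard : (univ.filter fun x => p x = 1 ∨ ∃ j, p j = 1 ∧ beats j x).card =
      Pop.card + U.card := by
    rw [← Finset.card_union_of_disjoint]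
    · congr 1
      ext x
      rcases hp x with h | h <;> simp [hPop, hU, h]
    · rw [Finset.disjoint_left]
      intro x hx hx'
      simp [hPop] at hx
      simp [hU, hx] at hx'
  have upper : ∀ σ : Fin (Fintype.card P) ≃ P, Vpop beats σ p ≤ Pop.card + U.card - 1 := by
    intro σ
    rw [Vpop_eq_sum_matches, matchesOf]
    have hn : (List.ofFn σ).Nodup := List.nodup_ofFn.mpr σ.injective
    have hall : ∀ x, x ∈ List.ofFn σ := fun x => by simpa using σ.surjective x
    have hc : (List.ofFn σ).countP (fun x => p x = 1 ∨ ∃ j, p j = 1 ∧ beats j x) =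
        Pop.card + U.card := by
      rw [← hcard]
      convert countP_eq_card_filter hn hall _
    obtain ⟨v, hv⟩ := hPne
    rcases hL : List.ofFn σ with _ | ⟨c, xs⟩
    · simpa [hL] using hall v
    · rw [hL] at hn hall hc
      rw [ctcMatchesL]
      refine Nat.le_sub_one_of_lt (hc ▸ ?_)
      convert sum_matches_lt_countP htot hp c xs hn ⟨v, hall v, by simpa [hPop] using hv⟩
  refine ⟨?_, by rintro _ ⟨σ, rfl⟩; exact upper σ⟩
  let r : P → P → Prop := fun a b => ¬ beats a b
  have hr : ∀ a b, r a b ∨ r b a := by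
    intro a b
    by_cases hab : a = b
    · exact Or.inl (hab ▸ hirr a)
    · exact (em (beats a b)).elim (fun h => Or.inr ((htot a b hab).mp h)) Or.inl
  have hperm : (Pop.toList.insertionSort r).Perm Pop.toList := List.perm_insertionSort r _
  have hchain := isChain_insertionSort hr Pop.toList
  have hpop : ∀ x, x ∈ Pop.toList.insertionSort r ↔ p x = 1 := fun x => by
    rw [hperm.mem_iff]; simp [hPop]
  have hlen : (Pop.toList.insertionSort r).length = Pop.card := by
    rw [hperm.length_eq, Finset.length_toList]
  have hgreedy : (seedGreedily beats (Pop.toList.insertionSort r) Popᶜ.toList).Perm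
      (Pop.toList ++ Popᶜ.toList) :=
    (seedGreedily_perm _ _ _).trans (hperm.append_right _)
  have hnodup : (Pop.toList ++ Popᶜ.toList).Nodup :=
    List.nodup_append'.mpr ⟨Finset.nodup_toList _, Finset.nodup_toList _, fun x => by simp⟩
  obtain ⟨σ, hσ⟩ := exists_equiv_ofFn_eq (hgreedy.nodup_iff.mpr hnodup)
    fun x => hgreedy.mem_iff.mpr (by simpa using em (x ∈ Pop))
  refine ⟨σ, le_antisymm (upper σ) ?_⟩
  simp only [Vpop_eq_sum_matches, matchesOf, hσ]
  rcases hL : Pop.toList.insertionSort r with _ | ⟨v, vs⟩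
  · obtain ⟨x, hx⟩ := hPne
    have := (hpop x).mpr (by simpa [hPop] using hx)
    simp [hL] at this
  · rw [hL] at hchain hpop hlen
    have h := le_sum_matches_seedGreedily v vs Popᶜ.toList (fun x hx => (hpop x).mp hx) hchain
    have hUcard : Popᶜ.toList.countP (fun u => ∃ j ∈ v :: vs, beats j u) = U.card := by
      rw [List.countP_eq_length_filter,
        ← List.toFinset_card_of_nodup ((Finset.nodup_toList _).filter _)]
      congr 1
      ext x
      rcases hp x with h | h <;>
        simp only [List.mem_toFinset, List.mem_filter, hpop] <;> simp [hPop, hU, h]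
    rw [List.length_cons] at hlen
    omega
end
end

section
/- Suppose the strength graph is a DAG and each player i has a win-value function f_i : {1,2,…} → ℕ; let F_i(ℓ) = Σ_{m=1}^{ℓ} f_i(m). For i ∈ {1,…,n} and 0 ≤ k ≤ i−1, let OPT(i,k) denote the maximum, over all subsets S ⊆ {1,…,i} with |S| = k+1 and all seedings σ of S (Challenge the Champ played among the players of S with the restricted beats relation), of the win-count-based tournament value of σ. Then OPT(i,0) = 0 for every i, and for every i and every 1 ≤ k ≤ i−1, OPT(i,k) equals the maximum of the following quantities: OPT(i−1, k) (this option only when k ≤ i−2), and F_i(ℓ) + OPT(i−1, k−ℓ) for each 1 ≤ ℓ ≤ k. -/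
open Finset

noncomputable section
open scoped Classical

variable {P : Type*}

/-- The number of matches won by player `i` when the seeding is the list `l`. -/
def winsL (beats : P → P → Prop) (l : List P) (i : P) : ℕ :=
  (ctcMatchesL beats l).countP fun m => decide (m.1 = i)

/-- The win-count-based tournament value of a seeding given as a list of players
from `{1,…,n}` (player `i` beats player `j` iff `i > j`), where `f i m` is the
value of the `m`-th match won by player `i`. -/
def valWC (n : ℕ) (f : ℕ → ℕ → ℕ) (l : List ℕ) : ℕ :=
  ∑ x ∈ Finset.Icc 1 n, ∑ m ∈ Finset.Icc 1 (winsL (fun a b : ℕ => b < a) l x), f x m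

theorem ctcMatches_append_s10 (beats : P → P → Prop) (c : P) (xs ys : List P) :
    ctcMatches beats c (xs ++ ys) =
      ctcMatches beats c xs ++ ctcMatches beats (ctcChamp beats c xs) ys := by
  induction xs generalizing c with
  | nil => simp [ctcMatches, ctcChamp]
  | cons x xs ih =>
    by_cases h : beats c x <;> simp [ctcMatches, ctcChamp, h, ih]

theorem ctcChamp_mem (beats : P → P → Prop) (c : P) (xs : List P) :
    ctcChamp beats c xs ∈ c :: xs := by
  induction xs generalizing c with
  | nil => simp [ctcChamp]
  | cons x xs ih =>
    by_cases h : beats c x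
    · have := ih c
      simp only [ctcChamp, h, if_true, List.mem_cons] at this ⊢
      tauto
    · simpa only [ctcChamp, h, if_false] using List.mem_cons_of_mem c (ih x)

theorem ctcMatches_of_forall_beats (beats : P → P → Prop) (c : P) (xs : List P)
    (h : ∀ x ∈ xs, beats c x) : ctcMatches beats c xs = xs.map fun x => (c, x) := by
  induction xs with
  | nil => simp [ctcMatches]
  | cons x xs ih => simp_all [ctcMatches]

theorem fst_mem_of_mem_ctcMatches (beats : P → P → Prop) (c : P) (xs : List P) (m : P × P)
    (hm : m ∈ ctcMatches beats c xs) : m.1 ∈ c :: xs := by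
  induction xs generalizing c with
  | nil => simp [ctcMatches] at hm
  | cons x xs ih =>
    by_cases h : beats c x
    · simp only [ctcMatches, h, if_true, List.mem_cons] at hm
      rcases hm with rfl | hm
      · simp
      · have := ih c hm
        simp only [List.mem_cons] at this ⊢
        tauto
    · simp only [ctcMatches, h, if_false, List.mem_cons] at hm
      rcases hm with rfl | hm
      · simp
      · exact List.mem_cons_of_mem c (ih x hm)

theorem winsL_eq_zero_of_notMem (beats : P → P → Prop) (l : List P) (i : P) (hi : i ∉ l) :
    winsL beats l i = 0 := by
  cases l with
  | nil => simp [winsL, ctcMatchesL]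
  | cons c xs =>
    simp only [winsL, ctcMatchesL, List.countP_eq_zero, decide_eq_true_eq]
    rintro m hm rfl
    exact hi (fst_mem_of_mem_ctcMatches beats c xs m hm)

theorem winsL_cons_of_forall_beats (beats : P → P → Prop) (i : P) (b : List P)
    (hb : ∀ y ∈ b, beats i y) (x : P) :
    winsL beats (i :: b) x = if x = i then b.length else 0 := by
  rw [winsL, ctcMatchesL, ctcMatches_of_forall_beats beats i b hb, List.countP_map]
  split_ifs with h
  · subst h
    simp [Function.comp_def]
  · simp [Function.comp_def, Ne.symm h]

theorem winsL_append_cons (beats : P → P → Prop) (i : P) (a b : List P) (ha : a ≠ [])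
    (hab : ∀ y ∈ a, ¬ beats y i) (hb : ∀ y ∈ b, beats i y) (x : P) :
    winsL beats (a ++ i :: b) x = winsL beats a x + if x = i then b.length + 1 else 0 := by
  obtain ⟨c, xs, rfl⟩ := List.exists_cons_of_ne_nil ha
  have hc := hab _ (ctcChamp_mem beats c xs)
  simp only [winsL, List.cons_append, ctcMatchesL, ctcMatches_append_s10, ctcMatches, hc, if_false,
    ctcMatches_of_forall_beats beats i b hb, List.countP_append, List.countP_cons,
    List.countP_map]
  by_cases h : x = i
  · subst h
    simp [Function.comp_def]
  · simp [Function.comp_def, h, Ne.symm h]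

theorem valWC_cons_of_forall_lt (n : ℕ) (f : ℕ → ℕ → ℕ) (i : ℕ) (hi : i ∈ Finset.Icc 1 n)
    (b : List ℕ) (hb : ∀ y ∈ b, y < i) :
    valWC n f (i :: b) = ∑ m ∈ Finset.Icc 1 b.length, f i m := by
  rw [valWC, Finset.sum_eq_single_of_mem i hi]
  · rw [winsL_cons_of_forall_beats _ i b hb, if_pos rfl]
  · intro x _ hx
    rw [winsL_cons_of_forall_beats _ i b hb, if_neg hx]
    simp

theorem valWC_append_cons (n : ℕ) (f : ℕ → ℕ → ℕ) (i : ℕ) (hi : i ∈ Finset.Icc 1 n)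
    (a b : List ℕ) (ha : a ≠ []) (hai : ∀ y ∈ a, y < i) (hb : ∀ y ∈ b, y < i) :
    valWC n f (a ++ i :: b) =
      (∑ m ∈ Finset.Icc 1 (b.length + 1), f i m) + valWC n f a := by
  have hw := winsL_append_cons (fun a b : ℕ => b < a) i a b ha
    (fun y hy => (hai y hy).le.not_gt) hb
  have h₀ := winsL_eq_zero_of_notMem (fun a b : ℕ => b < a) a i
    (fun h => (hai i h).false)
  rw [valWC, valWC, ← Finset.add_sum_erase _ _ hi, ← Finset.add_sum_erase _ _ hi, hw, h₀,
    if_pos rfl, zero_add]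
  simp only [zero_lt_one, Finset.Icc_eq_empty_of_lt, Finset.sum_empty, zero_add]
  congr 1
  refine Finset.sum_congr rfl fun x hx => ?_
  rw [hw, if_neg (Finset.ne_of_mem_erase hx), add_zero]

theorem valWC_singleton (n : ℕ) (f : ℕ → ℕ → ℕ) (c : ℕ) : valWC n f [c] = 0 := by
  simp [valWC, winsL, ctcMatchesL, ctcMatches]

theorem length_le_of_nodup_of_forall_mem_Icc {s : List ℕ} {i : ℕ} (hs : s.Nodup)
    (h : ∀ x ∈ s, 1 ≤ x ∧ x ≤ i) : s.length ≤ i := by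
  have hsub : s.toFinset ⊆ Finset.Icc 1 i :=
    fun x hx => Finset.mem_Icc.2 (h x (List.mem_toFinset.1 hx))
  simpa [List.toFinset_card_of_nodup hs] using Finset.card_le_card hsub

theorem exists_nodup_disjoint_list_Icc {a : List ℕ} {i m : ℕ} (h : a.length + m ≤ i) :
    ∃ b : List ℕ, b.Nodup ∧ b.length = m ∧ (∀ x ∈ b, 1 ≤ x ∧ x ≤ i) ∧ a.Disjoint b := by
  have hcard : m ≤ (Finset.Icc 1 i \ a.toFinset).card := by
    have h₁ := Finset.le_card_sdiff a.toFinset (Finset.Icc 1 i)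
    have h₂ := a.toFinset_card_le
    rw [Nat.card_Icc] at h₁
    omega
  obtain ⟨t, ht, rfl⟩ := Finset.exists_subset_card_eq hcard
  refine ⟨t.toList, t.nodup_toList, t.length_toList, fun x hx => ?_, fun x hxa hxb => ?_⟩
  · have := ht (Finset.mem_toList.1 hx)
    simp_all
  · have := ht (Finset.mem_toList.1 hxb)
    simp_all

/-- Correctness of the dynamic-programming recurrence for win-count-based values on
a DAG strength graph (players `1,…,n`, `i` beats `j` iff `i > j`). If
`Opt i k` is the maximum, over all `(k+1)`-element subsets `S ⊆ {1,…,i}` and all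
seedings of `S` (given as duplicate-free lists of length `k+1`), of the
win-count-based value, then `Opt i 0 = 0`, and for `1 ≤ k ≤ i − 1`, `Opt i k` is
the maximum of `Opt (i-1) k` (only when `k ≤ i − 2`) and of
`F_i ℓ + Opt (i-1) (k - ℓ)` for `1 ≤ ℓ ≤ k`, where `F_i ℓ = ∑_{m=1}^{ℓ} f i m`. -/
theorem ctc_dag_win_count_dp (n : ℕ) (hn : 1 ≤ n) (f : ℕ → ℕ → ℕ)
    (Opt : ℕ → ℕ → ℕ)
    (hOpt : ∀ i k, 1 ≤ i → i ≤ n → k ≤ i - 1 →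
      IsGreatest
        {v : ℕ | ∃ s : List ℕ, s.Nodup ∧ s.length = k + 1 ∧
          (∀ x ∈ s, 1 ≤ x ∧ x ≤ i) ∧ v = valWC n f s}
        (Opt i k)) :
    (∀ i, 1 ≤ i → i ≤ n → Opt i 0 = 0) ∧
    (∀ i k, 1 ≤ i → i ≤ n → 1 ≤ k → k ≤ i - 1 →
      IsGreatest
        {v : ℕ | (k ≤ i - 2 ∧ v = Opt (i - 1) k) ∨
          ∃ ℓ, 1 ≤ ℓ ∧ ℓ ≤ k ∧
            v = (∑ m ∈ Finset.Icc 1 ℓ, f i m) + Opt (i - 1) (k - ℓ)}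
        (Opt i k)) := by
  have hzero : ∀ i, 1 ≤ i → i ≤ n → Opt i 0 = 0 := by
    intro i h1 hin
    obtain ⟨s, -, hl, -, hv⟩ := (hOpt i 0 h1 hin (Nat.zero_le _)).1
    obtain ⟨c, rfl⟩ := List.length_eq_one_iff.1 hl
    rw [hv, valWC_singleton]
  refine ⟨hzero, fun i k h1 hin hk hki => ?_⟩
  have hi : i ∈ Finset.Icc 1 n := Finset.mem_Icc.2 ⟨h1, hin⟩
  have hub : Opt i k ∈ upperBounds {v : ℕ | (k ≤ i - 2 ∧ v = Opt (i - 1) k) ∨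
      ∃ ℓ, 1 ≤ ℓ ∧ ℓ ≤ k ∧
        v = (∑ m ∈ Finset.Icc 1 ℓ, f i m) + Opt (i - 1) (k - ℓ)} := by
    rintro v (⟨hk2, rfl⟩ | ⟨ℓ, hℓ1, hℓk, rfl⟩)
    · obtain ⟨s, hs, hl, hm, hv⟩ :=
        (hOpt (i - 1) k (by omega) (by omega) (by omega)).1
      exact (hOpt i k h1 hin hki).2
        ⟨s, hs, hl, fun x hx => ⟨(hm x hx).1, by have := (hm x hx).2; omega⟩, hv⟩
    · obtain ⟨a, ha, hal, ham, hav⟩ :=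
        (hOpt (i - 1) (k - ℓ) (by omega) (by omega) (by omega)).1
      obtain ⟨b, hb, hbl, hbm, hab⟩ :=
        exists_nodup_disjoint_list_Icc (a := a) (i := i - 1) (m := ℓ - 1) (by omega)
      have hai : ∀ y ∈ a, y < i := fun y hy => by have := ham y hy; omega
      have hbi : ∀ y ∈ b, y < i := fun y hy => by have := hbm y hy; omega
      refine (hOpt i k h1 hin hki).2 ⟨a ++ i :: b, ?_, ?_, ?_, ?_⟩
      · refine List.nodup_append'.2
          ⟨ha, List.nodup_cons.2 ⟨fun h => (hbi i h).false, hb⟩, ?_⟩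
        exact List.disjoint_cons_right.2 ⟨fun h => (hai i h).false, hab⟩
      · simp only [List.length_append, List.length_cons]
        omega
      · intro x hx
        rcases List.mem_append.1 hx with hx | hx
        · exact ⟨(ham x hx).1, (hai x hx).le⟩
        · rcases List.mem_cons.1 hx with rfl | hx
          · exact ⟨h1, le_rfl⟩
          · exact ⟨(hbm x hx).1, (hbi x hx).le⟩
      · rw [valWC_append_cons n f i hi a b (by rintro rfl; simp at hal) hai hbi, ← hav, hbl,
          Nat.sub_add_cancel hℓ1]
  refine ⟨?_, hub⟩
  obtain ⟨s, hs, hl, hm, hv⟩ := (hOpt i k h1 hin hki).1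
  by_cases his : i ∈ s
  · obtain ⟨a, b, rfl⟩ := List.append_of_mem his
    obtain ⟨ha, hb, hab⟩ := List.nodup_append'.1 hs
    have hai : ∀ y ∈ a, y < i := fun y hy =>
      lt_of_le_of_ne (hm y (by simp [hy])).2 fun h => hab hy (by simp [h])
    have hbi : ∀ y ∈ b, y < i := fun y hy =>
      lt_of_le_of_ne (hm y (by simp [hy])).2 fun h => (List.nodup_cons.1 hb).1 (h ▸ hy)
    simp only [List.length_append, List.length_cons] at hl
    rcases eq_or_ne a [] with rfl | hne
    · refine Or.inr ⟨k, hk, le_rfl, ?_⟩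
      rw [List.nil_append, valWC_cons_of_forall_lt n f i hi b hbi] at hv
      rw [Nat.sub_self, hzero (i - 1) (by omega) (by omega), hv]
      simp only [List.length_nil] at hl
      rw [show b.length = k by omega, add_zero]
    · have hpos := List.length_pos_iff.2 hne
      rw [valWC_append_cons n f i hi a b hne hai hbi] at hv
      have hle : valWC n f a ≤ Opt (i - 1) (k - (b.length + 1)) :=
        (hOpt (i - 1) (k - (b.length + 1)) (by omega) (by omega) (by omega)).2
          ⟨a, ha, by omega,
            fun x hx => ⟨(hm x (by simp [hx])).1, Nat.le_sub_one_of_lt (hai x hx)⟩, rfl⟩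
      refine Or.inr ⟨b.length + 1, by omega, by omega, le_antisymm ?_ ?_⟩
      · rw [hv]
        exact Nat.add_le_add_left hle _
      · exact hub (Or.inr ⟨b.length + 1, by omega, by omega, rfl⟩)
  · have hm' : ∀ x ∈ s, 1 ≤ x ∧ x ≤ i - 1 := fun x hx =>
      ⟨(hm x hx).1, Nat.le_sub_one_of_lt
        (lt_of_le_of_ne (hm x hx).2 fun h => his (h ▸ hx))⟩
    have hlen := length_le_of_nodup_of_forall_mem_Icc hs hm'
    have hk2 : k ≤ i - 2 := by omega
    refine Or.inl ⟨hk2, le_antisymm ?_ (hub (Or.inl ⟨hk2, rfl⟩))⟩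
    exact (hOpt (i - 1) k (by omega) (by omega) (by omega)).2 ⟨s, hs, hl, hm', hv⟩
end
end

section
/- Let G = (V, E) be a finite simple graph with |V| = n ≥ 2 and let k ∈ ℕ. Let N consist of a player p_v for each v ∈ V and a player p_e^ℓ for each e ∈ E and each ℓ ∈ {1,…,n²}, and let `beats` be any tournament relation on N satisfying: for every v ∈ V, e ∈ E, and ℓ, p_v beats p_e^ℓ if v is an endpoint of e, and p_e^ℓ beats p_v if v is not an endpoint of e. For a seeding σ, define its value as |{v ∈ V : w_{p_v}(σ) ≥ d(v)·n²}|, where d(v) is the degree of v in G. Then there exists a seeding of value at least k if and only if G has an independent set of size k. -/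
open Finset

noncomputable section
open scoped Classical

variable {P : Type*}

section ChallengeTheChamp

theorem snd_mem_of_mem_ctcMatches {beats : P → P → Prop} {i j c : P} {xs : List P}
    (h : (i, j) ∈ ctcMatches beats c xs) : j ∈ c :: xs := by
  induction xs generalizing c with
  | nil => simp [ctcMatches] at h
  | cons x xs ih =>
    unfold ctcMatches at h
    grind

theorem beats_of_mem_ctcMatches {beats : P → P → Prop}
    (htot : ∀ i j, i ≠ j → (beats i j ↔ ¬ beats j i)) {i j c : P} {xs : List P}
    (hnd : (c :: xs).Nodup) (h : (i, j) ∈ ctcMatches beats c xs) : beats i j := by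
  induction xs generalizing c with
  | nil => simp [ctcMatches] at h
  | cons x xs ih =>
    unfold ctcMatches at h
    grind

theorem fst_eq_of_mem_ctcMatches {beats : P → P → Prop} {i i' j c : P} {xs : List P}
    (hnd : (c :: xs).Nodup) (h : (i, j) ∈ ctcMatches beats c xs)
    (h' : (i', j) ∈ ctcMatches beats c xs) : i = i' := by
  induction xs generalizing c with
  | nil => simp [ctcMatches] at h
  | cons x xs ih =>
    unfold ctcMatches at h h'
    have := @snd_mem_of_mem_ctcMatches P beats
    grind

theorem mem_Mset [Fintype P] {beats : P → P → Prop} {n : ℕ} {σ : Fin n → P} {i j : P} :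
    j ∈ Mset beats σ i ↔ (i, j) ∈ ctcMatchesL beats (List.ofFn σ) := by
  rw [Mset, Finset.mem_filter, matchesOf]
  simp only [mem_univ, true_and]

theorem beats_of_mem_Mset [Fintype P] {beats : P → P → Prop}
    (htot : ∀ i j, i ≠ j → (beats i j ↔ ¬ beats j i)) {n : ℕ} {σ : Fin n → P}
    (hσ : Function.Injective σ) {i j : P} (h : j ∈ Mset beats σ i) : beats i j := by
  have hnd := List.nodup_ofFn.2 hσ
  rw [mem_Mset] at h
  cases hl : List.ofFn σ with
  | nil => simp [hl, ctcMatchesL] at h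
  | cons c xs =>
    rw [hl] at h hnd
    exact beats_of_mem_ctcMatches htot hnd h

theorem disjoint_Mset [Fintype P] {beats : P → P → Prop} {n : ℕ} {σ : Fin n → P}
    (hσ : Function.Injective σ) {i i' : P} (hne : i ≠ i') :
    Disjoint (Mset beats σ i) (Mset beats σ i') := by
  have hnd := List.nodup_ofFn.2 hσ
  rw [Finset.disjoint_left]
  intro j h h'
  rw [mem_Mset] at h h'
  cases hl : List.ofFn σ with
  | nil => simp [hl, ctcMatchesL] at h
  | cons c xs =>
    rw [hl] at h h' hnd
    exact hne (fst_eq_of_mem_ctcMatches hnd h h')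

theorem ctcMatches_append_of_forall_beats {beats : P → P → Prop} {c : P} {xs : List P}
    (ys : List P) (h : ∀ x ∈ xs, beats c x) :
    ctcMatches beats c (xs ++ ys) = xs.map (Prod.mk c) ++ ctcMatches beats c ys := by
  induction xs with
  | nil => rfl
  | cons x xs ih =>
    simp only [List.forall_mem_cons] at h
    simp [ctcMatches, h.1, ih h.2]

/-- If the players `p v` are seeded along a chain in which each one beats its predecessor, and
each `p v` is directly followed by a block `B v` of players it beats, then every `p v` wins
against its whole block. -/
theorem mem_ctcMatches_of_isChain {V : Type*} {beats : P → P → Prop} {p : V → P}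
    {B : V → List P} (hB : ∀ v, ∀ x ∈ B v, beats (p v) x) (rest : List P) {v : V} {vs : List V}
    (hc : (v :: vs).IsChain fun a b => ¬ beats (p a) (p b))
    {w : V} (hw : w ∈ v :: vs) {x : P} (hx : x ∈ B w) :
    (p w, x) ∈
      ctcMatches beats (p v) (B v ++ (vs.flatMap (fun u => p u :: B u) ++ rest)) := by
  induction vs generalizing v with
  | nil =>
    obtain rfl : w = v := by simpa using hw
    rw [ctcMatches_append_of_forall_beats _ (hB w)]
    simp [hx]
  | cons u us ih =>
    rw [ctcMatches_append_of_forall_beats _ (hB v)]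
    rw [List.isChain_cons_cons] at hc
    rcases List.mem_cons.1 hw with rfl | hw
    · simp [hx]
    · have := ih hc.2 hw
      simp only [List.flatMap_cons, List.cons_append, List.append_assoc, ctcMatches, if_neg hc.1,
        List.mem_append, List.mem_cons]
      exact Or.inr (Or.inr this)

/-- Every list can be rearranged into a chain for a relation that is total on distinct
elements. -/
theorem exists_perm_isChain {V : Type*} {r : V → V → Prop} (hr : ∀ a b, a ≠ b → r a b ∨ r b a)
    (l : List V) (hl : l.Nodup) : ∃ l' : List V, l'.Perm l ∧ l'.IsChain r := by
  have insert_aux : ∀ (x : V) (l : List V), x ∉ l → l.IsChain r →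
      ∃ l' : List V, l'.Perm (x :: l) ∧ l'.IsChain r ∧ (l'.head? = some x ∨ l'.head? = l.head?) := by
    intro x l
    induction l with
    | nil => exact fun _ _ => ⟨[x], by simp⟩
    | cons y l ih =>
      intro hx hc
      simp only [List.mem_cons, not_or] at hx
      by_cases hxy : r x y
      · exact ⟨x :: y :: l, List.Perm.refl _, List.isChain_cons_cons.2 ⟨hxy, hc⟩, by simp⟩
      · obtain ⟨l', hp, hc', hh⟩ := ih hx.2 hc.tail
        have hyx := (hr x y hx.1).resolve_left hxy
        refine ⟨y :: l', (hp.cons y).trans (List.Perm.swap x y l), ?_, by simp⟩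
        rw [List.isChain_cons] at hc ⊢
        refine ⟨?_, hc'⟩
        rcases hh with hh | hh <;> rw [hh]
        · simpa using hyx
        · exact hc.1
  induction l with
  | nil => exact ⟨[], by simp⟩
  | cons x l ih =>
    rw [List.nodup_cons] at hl
    obtain ⟨l₁, hp, hc⟩ := ih hl.2
    obtain ⟨l₂, hp', hc', -⟩ := insert_aux x l₁ (fun h => hl.1 (hp.subset h)) hc
    exact ⟨l₂, hp'.trans (hp.cons x), hc'⟩

/-- A duplicate-free list can be completed to a seeding of which it is a prefix. -/
theorem exists_equiv_ofFn_eq_append [Fintype P] {l : List P} (hl : l.Nodup) :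
    ∃ (σ : Fin (Fintype.card P) ≃ P) (rest : List P), List.ofFn σ = l ++ rest := by
  set rest := (univ.filter fun x => x ∉ l).toList with hrest
  have hnd : (l ++ rest).Nodup := by
    refine List.nodup_append'.2 ⟨hl, Finset.nodup_toList _, ?_⟩
    intro x hx hx'
    simp [hrest] at hx'
    exact hx' hx
  have hmem : ∀ x, x ∈ l ++ rest := by
    intro x
    simp [hrest, em]
  let τ := hnd.getEquivOfForallMemList _ hmem
  have hcard : Fintype.card P = (l ++ rest).length := by
    simpa using (Fintype.card_congr τ).symm
  refine ⟨(finCongr hcard).trans τ, rest, ?_⟩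
  apply List.ext_getElem
  · rw [List.length_ofFn, hcard]
  · intro i h₁ h₂
    simp [τ]

end ChallengeTheChamp

section EdgePlayers

variable {V : Type*} (G : SimpleGraph V) [Fintype G.edgeSet] (m : ℕ)

/-- The players attached to the edges incident to `v`, each edge carrying `m` players. -/
def incidentPlayers (v : V) : Finset (V ⊕ ({e // e ∈ G.edgeFinset} × Fin m)) :=
  ((univ.filter fun e : {e // e ∈ G.edgeFinset} => v ∈ (e : Sym2 V)) ×ˢ univ).map
    Function.Embedding.inr

variable {G m}

theorem inr_mem_incidentPlayers {v : V} {e : {e // e ∈ G.edgeFinset}} {ℓ : Fin m} :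
    Sum.inr (e, ℓ) ∈ incidentPlayers G m v ↔ v ∈ (e : Sym2 V) := by
  simp [incidentPlayers]

theorem inl_notMem_incidentPlayers {u v : V} : Sum.inl u ∉ incidentPlayers G m v := by
  simp [incidentPlayers]

theorem card_incidentPlayers (v : V) [Fintype (G.neighborSet v)] :
    (incidentPlayers G m v).card = G.degree v * m := by
  rw [incidentPlayers, card_map, card_product, Finset.card_univ, Fintype.card_fin]
  congr 1
  rw [← G.card_incidenceFinset_eq_degree v]
  refine Finset.card_bij (fun e _ => (e : Sym2 V)) ?_ ?_ ?_
  · rintro ⟨e, he⟩ h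
    simpa [SimpleGraph.incidenceSet] using And.intro (by simpa using he) (by simpa using h)
  · intro a _ b _ h
    exact Subtype.ext h
  · intro e he
    simp only [SimpleGraph.mem_incidenceFinset, SimpleGraph.incidenceSet, Set.mem_ofPred_eq] at he
    exact ⟨⟨e, by simpa using he.1⟩, by simpa using he.2, rfl⟩

theorem le_card_incidentPlayers_inter [DecidableEq V] {u w : V} (h : G.Adj u w) :
    m ≤ (incidentPlayers G m u ∩ incidentPlayers G m w).card := by
  have he : s(u, w) ∈ G.edgeFinset := by simpa using h
  calc m = (univ.image fun ℓ : Fin m =>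
        (Sum.inr (⟨s(u, w), he⟩, ℓ) : V ⊕ ({e // e ∈ G.edgeFinset} × Fin m))).card := by
        rw [Finset.card_image_of_injective _ (fun a b hab => by simpa using hab)]
        simp
    _ ≤ _ := by
        refine Finset.card_le_card ?_
        intro x hx
        obtain ⟨ℓ, -, rfl⟩ := Finset.mem_image.1 hx
        simp [inr_mem_incidentPlayers]

theorem disjoint_incidentPlayers {u w : V} (hne : u ≠ w) (h : ¬ G.Adj u w) :
    Disjoint (incidentPlayers G m u) (incidentPlayers G m w) := by
  rw [Finset.disjoint_left]
  rintro (x | ⟨e, ℓ⟩) hu hw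
  · exact inl_notMem_incidentPlayers hu
  · rw [inr_mem_incidentPlayers] at hu hw
    have he := (Sym2.mem_and_mem_iff hne).1 ⟨hu, hw⟩
    exact h (by simpa [he] using e.2)

end EdgePlayers

/-- Hardness reduction for binary-valued win-count-based values: from a simple
graph `G` on `n ≥ 2` vertices, take a player `p_v` for each vertex `v` and players
`p_e^ℓ`, `ℓ ∈ {1,…,n²}`, for each edge `e`, where `p_v` beats `p_e^ℓ` iff `v` is an
endpoint of `e`.  The value of a seeding is the number of vertices `v` whose player
wins at least `d(v)·n²` matches.  Some seeding attains value at least `k` iff `G`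
has an independent set of size `k`. -/
theorem ctc_binary_win_count_reduction {V : Type*} [Fintype V] [DecidableEq V]
    (G : SimpleGraph V) [DecidableRel G.Adj] [Fintype G.edgeSet]
    (hn : 2 ≤ Fintype.card V) (k : ℕ)
    (beats : (V ⊕ ({e // e ∈ G.edgeFinset} × Fin (Fintype.card V ^ 2))) →
             (V ⊕ ({e // e ∈ G.edgeFinset} × Fin (Fintype.card V ^ 2))) → Prop)
    (hirr : ∀ i, ¬ beats i i)
    (htot : ∀ i j, i ≠ j → (beats i j ↔ ¬ beats j i))
    (hve : ∀ (v : V) (e : {e // e ∈ G.edgeFinset}) (ℓ : Fin (Fintype.card V ^ 2)),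
      (v ∈ (e : Sym2 V) → beats (Sum.inl v) (Sum.inr (e, ℓ))) ∧
      (v ∉ (e : Sym2 V) → beats (Sum.inr (e, ℓ)) (Sum.inl v))) :
    (∃ σ : Fin (Fintype.card (V ⊕ ({e // e ∈ G.edgeFinset} × Fin (Fintype.card V ^ 2)))) ≃
        (V ⊕ ({e // e ∈ G.edgeFinset} × Fin (Fintype.card V ^ 2))),
      k ≤ (Finset.univ.filter fun v : V =>
        G.degree v * Fintype.card V ^ 2 ≤ wins beats (⇑σ) (Sum.inl v)).card) ↔
    (∃ I : Finset V, I.card = k ∧ ∀ u ∈ I, ∀ w ∈ I, ¬ G.Adj u w) := by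
  have beats_incident : ∀ v, ∀ x ∈ incidentPlayers G (Fintype.card V ^ 2) v,
      beats (Sum.inl v) x := by
    rintro v (x | ⟨e, ℓ⟩) hx
    · exact absurd hx inl_notMem_incidentPlayers
    · exact (hve v e ℓ).1 (inr_mem_incidentPlayers.1 hx)
  constructor
  · rintro ⟨σ, hσ⟩
    obtain ⟨I, hI, rfl⟩ := Finset.exists_subset_card_eq hσ
    refine ⟨I, rfl, fun u hu w hw hadj => ?_⟩
    have hu' := (Finset.mem_filter.1 (hI hu)).2
    have hw' := (Finset.mem_filter.1 (hI hw)).2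
    have hsub : ∀ v, Mset beats σ (Sum.inl v) ⊆
        incidentPlayers G (Fintype.card V ^ 2) v ∪ univ.map Function.Embedding.inl := by
      rintro v (x | ⟨e, ℓ⟩) hx
      · simp
      · refine Finset.mem_union_left _ (inr_mem_incidentPlayers.2 ?_)
        by_contra hv
        exact (htot _ _ Sum.inl_ne_inr).1 (beats_of_mem_Mset htot σ.injective hx)
          ((hve v e ℓ).2 hv)
    have hdisj := disjoint_Mset (beats := beats) σ.injective
      (Sum.inl_injective.ne hadj.ne : (Sum.inl u : V ⊕ _) ≠ Sum.inl w)
    have hcard : wins beats σ (Sum.inl u) + wins beats σ (Sum.inl w) ≤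
        (incidentPlayers G (Fintype.card V ^ 2) u ∪
          incidentPlayers G (Fintype.card V ^ 2) w).card + Fintype.card V := by
      rw [wins, wins, ← Finset.card_union_of_disjoint hdisj]
      calc _ ≤ ((incidentPlayers G (Fintype.card V ^ 2) u ∪
            incidentPlayers G (Fintype.card V ^ 2) w) ∪
            univ.map Function.Embedding.inl).card := by
            refine Finset.card_le_card (Finset.union_subset ?_ ?_)
            · exact (hsub u).trans (Finset.union_subset_union_left Finset.subset_union_left)
            · exact (hsub w).trans (Finset.union_subset_union_left Finset.subset_union_right)
        _ ≤ _ := (Finset.card_union_le _ _).trans (by simp)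
    have hinter := Finset.card_union_add_card_inter
      (incidentPlayers G (Fintype.card V ^ 2) u) (incidentPlayers G (Fintype.card V ^ 2) w)
    have hle := le_card_incidentPlayers_inter (m := Fintype.card V ^ 2) hadj
    rw [card_incidentPlayers, card_incidentPlayers] at hinter
    have : Fintype.card V < Fintype.card V ^ 2 := by nlinarith
    omega
  · rintro ⟨I, rfl, hI⟩
    obtain ⟨l, hl, hc⟩ := exists_perm_isChain
      (r := fun a b : V => ¬ beats (Sum.inl a) (Sum.inl b))
      (fun a b hab => by
        have := htot (Sum.inl a) (Sum.inl b) (Sum.inl_injective.ne hab)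
        tauto) I.toList I.nodup_toList
    have hmem : ∀ v, v ∈ l ↔ v ∈ I := fun v => by rw [hl.mem_iff, Finset.mem_toList]
    have hnd : (l.flatMap fun v =>
        Sum.inl v :: (incidentPlayers G (Fintype.card V ^ 2) v).toList).Nodup := by
      rw [List.nodup_flatMap]
      refine ⟨fun v _ => List.nodup_cons.2
        ⟨by simpa using inl_notMem_incidentPlayers, Finset.nodup_toList _⟩, ?_⟩
      refine (hl.nodup_iff.2 I.nodup_toList).imp_of_mem ?_
      intro u w hu hw hne
      have hd := Finset.disjoint_left.1 (disjoint_incidentPlayers (m := Fintype.card V ^ 2) hne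
        (hI u ((hmem u).1 hu) w ((hmem w).1 hw)))
      rintro (x | x) hx hx'
      · simp only [List.mem_cons, Sum.inl.injEq, Finset.mem_toList, inl_notMem_incidentPlayers,
          or_false] at hx hx'
        exact hne (hx.symm.trans hx')
      · exact hd (by simpa using hx) (by simpa using hx')
    obtain ⟨σ, rest, hσ⟩ := exists_equiv_ofFn_eq_append hnd
    refine ⟨σ, Finset.card_le_card fun v hv => ?_⟩
    rw [Finset.mem_filter, ← card_incidentPlayers]
    refine ⟨Finset.mem_univ _, Finset.card_le_card fun x hx => ?_⟩
    rw [mem_Mset, hσ]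
    have hvl := (hmem v).2 hv
    cases l with
    | nil => simp at hvl
    | cons u us =>
      have := mem_ctcMatches_of_isChain
        (B := fun v => (incidentPlayers G (Fintype.card V ^ 2) v).toList)
        (fun v x hx => beats_incident v x (Finset.mem_toList.1 hx)) rest hc hvl
        (Finset.mem_toList.2 hx)
      simpa [ctcMatchesL] using this
end
end
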